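/- arXiv:1704.08349 — 2 statements merged into one kernel-verified Lean document; each statement's English description precedes it below -/
import Mathlib

section
/- Probabilistic error bound for the initial Lasso estimator (bound (3.1) of Theorem 1): Let X be a real n×p matrix, C* a real p×q matrix with s = ‖C*‖₀ nonzero entries, σ_max > 0, c₀ > √2, c₂ > 0, pq ≥ 2, and λ₀ = c₀ σ_max (n⁻¹ log(pq))^{1/2}. On a probability space, let E be a random real n×q matrix such that for every i ≤ p and j ≤ q the real random variable (XᵀE)_{ij} is centered Gaussian with variance at most σ_max² n, and let C̃ be a measurable map into real p×q matrices such that almost surely (i) C̃ minimizes C ↦ (2n)⁻¹‖(XC* + E) − XC‖_F² + λ₀‖C‖₁ over all real p×q matrices, and (ii) n⁻¹‖X(C̃ − C*)‖_F² ≥ c₂‖C̃ − C*‖_F². Then with probability at least 1 − 2(pq)^{1 − c₀²/2} one has ‖C̃ − C*‖_F ≤ (12/c₂) s^{1/2} λ₀. -/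
open Matrix BigOperators MeasureTheory ProbabilityTheory

/-- Frobenius norm of a real matrix. -/
noncomputable def frobNorm {m n : ℕ} (M : Matrix (Fin m) (Fin n) ℝ) : ℝ :=
  Real.sqrt (∑ i, ∑ j, (M i j) ^ 2)

/-- Entrywise ℓ₁-norm of a real matrix. -/
noncomputable def l1Norm {m n : ℕ} (M : Matrix (Fin m) (Fin n) ℝ) : ℝ :=
  ∑ i, ∑ j, |M i j|

/-- Number of nonzero entries of a real matrix. -/
noncomputable def l0Norm {m n : ℕ} (M : Matrix (Fin m) (Fin n) ℝ) : ℕ :=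
  Nat.card {ij : Fin m × Fin n // M ij.1 ij.2 ≠ 0}


lemma frob_sq {m n : ℕ} (M : Matrix (Fin m) (Fin n) ℝ) :
    frobNorm M ^ 2 = ∑ i, ∑ j, (M i j) ^ 2 := by
  unfold frobNorm
  exact Real.sq_sqrt (Finset.sum_nonneg fun i _ => Finset.sum_nonneg fun j _ => sq_nonneg _)

lemma sum_adj {n p q : ℕ} (X : Matrix (Fin n) (Fin p) ℝ) (E : Matrix (Fin n) (Fin q) ℝ)
    (D : Matrix (Fin p) (Fin q) ℝ) :
    ∑ i, ∑ j, E i j * (X * D) i j = ∑ i, ∑ j, (Xᵀ * E) i j * D i j := by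
  have h1 : (Eᵀ * (X * D)).trace = ∑ i, ∑ j, E i j * (X * D) i j := by
    rw [Finset.sum_comm]; simp only [Matrix.trace, Matrix.diag, Matrix.mul_apply, Matrix.transpose_apply]
  have h2 : ((Xᵀ * E)ᵀ * D).trace = ∑ i, ∑ j, (Xᵀ * E) i j * D i j := by
    rw [Finset.sum_comm]; simp only [Matrix.trace, Matrix.diag, Matrix.mul_apply, Matrix.transpose_apply]
  rw [← h1, ← h2, Matrix.transpose_mul, Matrix.transpose_transpose, Matrix.mul_assoc]

lemma support_cs {p q : ℕ} (C D : Matrix (Fin p) (Fin q) ℝ) :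
    ∑ i, ∑ j, (if C i j ≠ 0 then |D i j| else 0) ≤ Real.sqrt (l0Norm C) * frobNorm D := by
  classical
  have hcard : (l0Norm C : ℝ) = ∑ x : Fin p × Fin q, (if C x.1 x.2 ≠ 0 then (1:ℝ) else 0) ^ 2 := by
    unfold l0Norm
    rw [Nat.card_eq_fintype_card, Fintype.card_subtype]
    simp [Finset.sum_ite, ite_pow]
  have hF : frobNorm D = Real.sqrt (∑ x : Fin p × Fin q, |D x.1 x.2| ^ 2) := by
    unfold frobNorm; rw [Fintype.sum_prod_type]; simp
  rw [hcard, hF, ← Fintype.sum_prod_type' (f := fun i j => if C i j ≠ 0 then |D i j| else 0)]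
  refine le_trans (le_of_eq ?_) (Real.sum_mul_le_sqrt_mul_sqrt _ _ _)
  refine Finset.sum_congr rfl fun x _ => ?_
  split_ifs <;> simp

lemma lasso_det {n p q : ℕ} (hn : 0 < n)
    (X : Matrix (Fin n) (Fin p) ℝ) (Cs C : Matrix (Fin p) (Fin q) ℝ)
    (E : Matrix (Fin n) (Fin q) ℝ) (c2 lam : ℝ) (hc2 : 0 < c2) (hl : 0 ≤ lam)
    (hE : ∀ i j, |(Xᵀ * E) i j| ≤ n * lam)
    (hmin : (2 * n : ℝ)⁻¹ * (frobNorm ((X * Cs + E) - X * C)) ^ 2 + lam * l1Norm C ≤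
          (2 * n : ℝ)⁻¹ * (frobNorm ((X * Cs + E) - X * Cs)) ^ 2 + lam * l1Norm Cs)
    (hre : c2 * (frobNorm (C - Cs)) ^ 2 ≤ (n : ℝ)⁻¹ * (frobNorm (X * (C - Cs))) ^ 2) :
    frobNorm (C - Cs) ≤ (12 / c2) * Real.sqrt (l0Norm Cs) * lam := by
  have hn' : (0:ℝ) < n := by exact_mod_cast hn
  set D := C - Cs with hD
  have e1 : (X * Cs + E) - X * C = E - X * D := by rw [hD, Matrix.mul_sub]; abel
  have e2 : (X * Cs + E) - X * Cs = E := by abel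
  rw [e1, e2] at hmin
  have hexp : frobNorm (E - X * D) ^ 2 = frobNorm E ^ 2
      - 2 * ∑ i, ∑ j, (Xᵀ * E) i j * D i j + frobNorm (X * D) ^ 2 := by
    rw [← sum_adj, frob_sq, frob_sq, frob_sq]
    simp only [Finset.mul_sum, ← Finset.sum_sub_distrib, ← Finset.sum_add_distrib]
    refine Finset.sum_congr rfl fun i _ => Finset.sum_congr rfl fun j _ => ?_
    rw [Matrix.sub_apply]; ring
  have hnoise : ∑ i, ∑ j, (Xᵀ * E) i j * D i j ≤ n * lam * l1Norm D := by
    unfold l1Norm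
    simp only [Finset.mul_sum]
    refine Finset.sum_le_sum fun i _ => Finset.sum_le_sum fun j _ => ?_
    refine (le_abs_self _).trans ?_
    rw [abs_mul]
    exact mul_le_mul_of_nonneg_right (hE i j) (abs_nonneg _)
  have hl1 : l1Norm D + l1Norm Cs - l1Norm C ≤ 2 * (Real.sqrt (l0Norm Cs) * frobNorm D) := by
    refine le_trans ?_ (mul_le_mul_of_nonneg_left (support_cs Cs D) (by norm_num))
    unfold l1Norm
    simp only [Finset.mul_sum, ← Finset.sum_sub_distrib, ← Finset.sum_add_distrib]
    refine Finset.sum_le_sum fun i _ => Finset.sum_le_sum fun j _ => ?_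
    rw [hD, Matrix.sub_apply]
    split_ifs with h
    · have := abs_sub_abs_le_abs_sub (Cs i j) (C i j)
      rw [abs_sub_comm] at this
      linarith
    · simp only [ne_eq, not_not] at h
      simp [h]
  have hF : 0 ≤ frobNorm D := Real.sqrt_nonneg _
  set F := frobNorm D
  set S := Real.sqrt (l0Norm Cs)
  have hS : 0 ≤ S := Real.sqrt_nonneg _
  rw [hexp] at hmin
  set T := ∑ i, ∑ j, (Xᵀ * E) i j * D i j
  have k1 : (n:ℝ)⁻¹ * frobNorm (X * D) ^ 2 ≤ 2 * ((n:ℝ)⁻¹ * T) + 2 * (lam * (l1Norm Cs - l1Norm C)) := by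
    have : (2 * n : ℝ)⁻¹ = (n:ℝ)⁻¹ / 2 := by rw [mul_inv]; ring
    rw [this] at hmin
    linarith
  have k2 : (n:ℝ)⁻¹ * T ≤ lam * l1Norm D := by
    rw [inv_mul_le_iff₀ hn']; linarith
  have k3 := mul_le_mul_of_nonneg_left hl1 hl
  have k4 : c2 * F ^ 2 ≤ 4 * lam * S * F := by nlinarith
  rcases hF.eq_or_lt with h0 | h0
  · rw [← h0]; positivity
  · have k5 : c2 * F ≤ 4 * lam * S := by
      refine le_of_mul_le_mul_right ?_ h0
      linarith
    have k6 : 0 ≤ lam * S := mul_nonneg hl hS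
    have : (12 / c2) * S * lam = (12 * (lam * S)) / c2 := by ring
    rw [this, le_div_iff₀ hc2]
    linarith

lemma gauss_subG (v : NNReal) (w : NNReal) (h : v ≤ w) :
    HasSubgaussianMGF id w (gaussianReal 0 v) where
  integrable_exp_mul t := integrable_exp_mul_gaussianReal t
  mgf_le t := by
    rw [mgf_id_gaussianReal]
    have : (v:ℝ) ≤ w := h
    simp only [zero_mul, zero_add]
    gcongr

lemma gauss_tail (v : NNReal) (w : NNReal) (h : v ≤ w) (t : ℝ) (ht : 0 ≤ t) :
    gaussianReal 0 v {x | t ≤ |x|} ≤ ENNReal.ofReal (2 * Real.exp (- t ^ 2 / (2 * w))) := by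
  have hs : {x : ℝ | t ≤ |x|} ⊆ {x | t ≤ id x} ∪ {x | t ≤ (-id) x} := by
    intro x hx
    have hx' : t ≤ |x| := hx
    rcases le_abs.1 hx' with h | h
    · exact Or.inl h
    · exact Or.inr h
  have h1 := (gauss_subG v w h).measure_ge_le ht
  have h2 := (gauss_subG v w h).neg.measure_ge_le ht
  refine (measure_mono hs).trans ((measure_union_le _ _).trans ?_)
  rw [two_mul, ENNReal.ofReal_add (by positivity) (by positivity)]
  refine add_le_add ?_ ?_
  · rw [← ofReal_measureReal]; exact ENNReal.ofReal_le_ofReal h1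
  · rw [← ofReal_measureReal]; exact ENNReal.ofReal_le_ofReal h2

/-- Probabilistic error bound for the initial Lasso estimator (bound (3.1) of Theorem 1):
if each entry of `XᵀE` is centered Gaussian with variance at most `σ_max² n`, and `C̃` is
almost surely a minimizer of the ℓ₁-penalized squared loss satisfying the restricted
eigenvalue condition, then with probability at least `1 − 2(pq)^{1 − c₀²/2}` one has
`‖C̃ − C*‖_F ≤ (12/c₂) √s λ₀` with `s = ‖C*‖₀` and `λ₀ = c₀ σ_max √(n⁻¹ log(pq))`. -/
theorem lasso_probabilistic_error_bound {n p q : ℕ} (hn : 0 < n) (hpq : 2 ≤ p * q)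
    (X : Matrix (Fin n) (Fin p) ℝ) (Cstar : Matrix (Fin p) (Fin q) ℝ)
    (σmax c0 c2 : ℝ) (hσ : 0 < σmax) (hc0 : Real.sqrt 2 < c0) (hc2 : 0 < c2)
    (lam0 : ℝ) (hlam : lam0 = c0 * σmax * Real.sqrt ((n : ℝ)⁻¹ * Real.log (p * q)))
    {Ω : Type*} [MeasurableSpace Ω] (P : Measure Ω) [IsProbabilityMeasure P]
    (E : Ω → Matrix (Fin n) (Fin q) ℝ) (Ctil : Ω → Matrix (Fin p) (Fin q) ℝ)
    (hmeas : ∀ (i : Fin p) (j : Fin q), Measurable fun ω => Ctil ω i j)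
    (hGauss : ∀ (i : Fin p) (j : Fin q), ∃ v : NNReal, (v : ℝ) ≤ σmax ^ 2 * n ∧
      P.map (fun ω => (Xᵀ * E ω) i j) = gaussianReal 0 v)
    (hae : ∀ᵐ ω ∂P,
      (∀ C : Matrix (Fin p) (Fin q) ℝ,
        (2 * n : ℝ)⁻¹ * (frobNorm ((X * Cstar + E ω) - X * Ctil ω)) ^ 2
            + lam0 * l1Norm (Ctil ω) ≤
          (2 * n : ℝ)⁻¹ * (frobNorm ((X * Cstar + E ω) - X * C)) ^ 2 + lam0 * l1Norm C) ∧
      c2 * (frobNorm (Ctil ω - Cstar)) ^ 2 ≤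
        (n : ℝ)⁻¹ * (frobNorm (X * (Ctil ω - Cstar))) ^ 2) :
    ENNReal.ofReal (1 - 2 * (p * q : ℝ) ^ (1 - c0 ^ 2 / 2)) ≤
      P {ω | frobNorm (Ctil ω - Cstar) ≤ (12 / c2) * Real.sqrt (l0Norm Cstar) * lam0} := by
  have hn' : (0:ℝ) < n := by exact_mod_cast hn
  have hpq' : (2:ℝ) ≤ (p:ℝ) * q := by exact_mod_cast hpq
  have hN : (0:ℝ) < (p:ℝ) * q := by linarith
  have hlog : 0 ≤ Real.log ((p:ℝ) * q) := Real.log_nonneg (by linarith)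
  have hc0' : 0 ≤ c0 := (Real.sqrt_nonneg 2).trans hc0.le
  have hl : 0 ≤ lam0 := by rw [hlam]; positivity
  set w : NNReal := ⟨σmax ^ 2 * n, by positivity⟩ with hw
  have hexp : Real.exp (- ((n:ℝ) * lam0) ^ 2 / (2 * w)) = ((p:ℝ) * q) ^ (- (c0 ^ 2 / 2)) := by
    rw [Real.rpow_def_of_pos hN, hlam]
    congr 1
    have : (w:ℝ) = σmax ^ 2 * n := rfl
    rw [this, mul_pow, mul_pow, Real.sq_sqrt (by positivity)]
    field_simp
  have htail : ∀ (i : Fin p) (j : Fin q), P {ω | (n:ℝ) * lam0 ≤ |(Xᵀ * E ω) i j|} ≤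
      ENNReal.ofReal (2 * ((p:ℝ) * q) ^ (- (c0 ^ 2 / 2))) := by
    intro i j
    obtain ⟨v, hv, hmap⟩ := hGauss i j
    have hae : AEMeasurable (fun ω => (Xᵀ * E ω) i j) P := by
      by_contra hcon
      rw [Measure.map_of_not_aemeasurable hcon] at hmap
      exact IsProbabilityMeasure.ne_zero (gaussianReal 0 v) hmap.symm
    have := gauss_tail v w hv ((n:ℝ) * lam0) (by positivity)
    rw [hexp, ← hmap, Measure.map_apply_of_aemeasurable hae
      (measurableSet_le measurable_const (by fun_prop))] at this
    exact this
  set B : Set Ω := ⋃ x : Fin p × Fin q, {ω | (n:ℝ) * lam0 ≤ |(Xᵀ * E ω) x.1 x.2|} with hB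
  have hPB : P B ≤ ENNReal.ofReal (2 * ((p:ℝ) * q) ^ (1 - c0 ^ 2 / 2)) := by
    refine (measure_iUnion_fintype_le P _).trans ?_
    refine (Finset.sum_le_sum fun x _ => htail x.1 x.2).trans (le_of_eq ?_)
    rw [Finset.sum_const, Finset.card_univ, Fintype.card_prod, Fintype.card_fin, Fintype.card_fin,
      ← ENNReal.ofReal_nsmul]
    congr 1
    rw [sub_eq_add_neg, Real.rpow_add hN, Real.rpow_one, nsmul_eq_mul]
    push_cast; ring
  set G := {ω | frobNorm (Ctil ω - Cstar) ≤ (12 / c2) * Real.sqrt (l0Norm Cstar) * lam0}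
  have hcov : P Set.univ ≤ P (G ∪ B) := by
    refine measure_mono_ae ?_
    filter_upwards [hae] with ω hω _
    by_cases hb : ω ∈ B
    · exact Or.inr hb
    · left
      refine lasso_det hn X Cstar (Ctil ω) (E ω) c2 lam0 hc2 hl ?_ (hω.1 Cstar) hω.2
      intro i j
      by_contra hcon
      exact hb (Set.mem_iUnion.2 ⟨(i, j), (not_le.1 hcon).le⟩)
  rw [measure_univ] at hcov
  rw [ENNReal.ofReal_sub _ (by positivity), ENNReal.ofReal_one, tsub_le_iff_right]
  exact hcov.trans ((measure_union_le _ _).trans (add_le_add le_rfl hPB))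
end

section
/- Hölder bound for the empirical process term (inequality (A.15)): Let X be a real n×p matrix, E a real n×q matrix, Û, U* real p×q matrices, V̂, V* real q×q matrices, and D̂, D* diagonal q×q matrices with nonnegative diagonal entries; let D̂⁻ be the diagonal matrix with entries 1/d̂_j if d̂_j > 0 and 0 otherwise, and set Â = ÛD̂, B̂ = V̂D̂, A* = U*D*, B* = V*D*, Ĉ = ÛD̂V̂ᵀ, C* = U*D*V*ᵀ. If ‖n⁻¹ Xᵀ E B̂ D̂⁻‖_∞ ≤ λ_a, ‖n⁻¹ U*ᵀ Xᵀ E B̂ D̂⁻‖_∞ ≤ λ_d, and ‖n⁻¹ U*ᵀ Xᵀ E‖_∞ ≤ λ_b, then ⟨n⁻¹XᵀE, Ĉ − C*⟩ ≤ λ_a ‖Â − A*‖₁ + λ_d ‖D̂ − D*‖₁ + λ_b ‖B̂ − B*‖₁. -/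
open Matrix BigOperators

/-- Entrywise sup-norm of a real matrix. -/
noncomputable def supNorm {m n : ℕ} (M : Matrix (Fin m) (Fin n) ℝ) : ℝ :=
  ⨆ i, ⨆ j, |M i j|

/-- Trace inner product ⟨M, N⟩ = tr(Mᵀ N) of two real matrices of the same size. -/
noncomputable def mInner {m n : ℕ} (M N : Matrix (Fin m) (Fin n) ℝ) : ℝ :=
  Matrix.trace (Mᵀ * N)

/-- The pseudo-inverse `D⁻` of a diagonal matrix `D = diag(d)` with nonnegative entries:
its `j`-th diagonal entry is `1/d_j` if `d_j > 0` and `0` otherwise. -/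
noncomputable def diagPseudoInv {q : ℕ} (d : Fin q → ℝ) : Matrix (Fin q) (Fin q) ℝ :=
  Matrix.diagonal (fun j => if 0 < d j then (d j)⁻¹ else 0)

lemma entry_le_supNorm {m n : ℕ} (M : Matrix (Fin m) (Fin n) ℝ) (i : Fin m) (j : Fin n) :
    |M i j| ≤ supNorm M := by
  unfold supNorm
  refine le_trans ?_ (le_ciSup (f := fun i => ⨆ j, |M i j|) (Set.finite_range _).bddAbove i)
  exact le_ciSup (f := fun j => |M i j|) (Set.finite_range _).bddAbove j

lemma mInner_eq_sum {m n : ℕ} (M N : Matrix (Fin m) (Fin n) ℝ) :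
    mInner M N = ∑ i, ∑ j, M i j * N i j := by
  unfold mInner
  simp only [Matrix.trace, Matrix.diag, Matrix.mul_apply, Matrix.transpose_apply]
  exact Finset.sum_comm

lemma mInner_le_of_supNorm_le {m n : ℕ} (M N : Matrix (Fin m) (Fin n) ℝ) {c : ℝ}
    (h : supNorm M ≤ c) : mInner M N ≤ c * l1Norm N := by
  rw [mInner_eq_sum, l1Norm, Finset.mul_sum]
  refine Finset.sum_le_sum fun i _ => ?_
  rw [Finset.mul_sum]
  refine Finset.sum_le_sum fun j _ => ?_
  calc M i j * N i j ≤ |M i j| * |N i j| := by rw [← abs_mul]; exact le_abs_self _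
    _ ≤ c * |N i j| :=
      mul_le_mul_of_nonneg_right ((entry_le_supNorm M i j).trans h) (abs_nonneg _)

lemma l1Norm_transpose {m n : ℕ} (M : Matrix (Fin m) (Fin n) ℝ) : l1Norm Mᵀ = l1Norm M := by
  unfold l1Norm
  simp only [Matrix.transpose_apply]
  exact Finset.sum_comm

lemma l1Norm_sub_comm {m n : ℕ} (M N : Matrix (Fin m) (Fin n) ℝ) :
    l1Norm (M - N) = l1Norm (N - M) := by
  unfold l1Norm
  simp only [Matrix.sub_apply, abs_sub_comm]

lemma mInner_mul_transpose {m n k : ℕ} (G : Matrix (Fin m) (Fin n) ℝ)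
    (N : Matrix (Fin m) (Fin k) ℝ) (W : Matrix (Fin n) (Fin k) ℝ) :
    mInner G (N * Wᵀ) = mInner (G * W) N := by
  unfold mInner
  rw [Matrix.transpose_mul, ← Matrix.mul_assoc, Matrix.trace_mul_comm, Matrix.mul_assoc]

lemma mInner_mul_left {m n k : ℕ} (G : Matrix (Fin m) (Fin n) ℝ)
    (U : Matrix (Fin m) (Fin k) ℝ) (N : Matrix (Fin k) (Fin n) ℝ) :
    mInner G (U * N) = mInner (Uᵀ * G) N := by
  unfold mInner
  rw [Matrix.transpose_mul, Matrix.transpose_transpose, Matrix.mul_assoc]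

lemma mInner_add {m n : ℕ} (G M N : Matrix (Fin m) (Fin n) ℝ) :
    mInner G (M + N) = mInner G M + mInner G N := by
  unfold mInner
  rw [Matrix.mul_add, Matrix.trace_add]

lemma diagonal_mul_W {q : ℕ} (d : Fin q → ℝ) (hd : ∀ j, 0 ≤ d j)
    (V : Matrix (Fin q) (Fin q) ℝ) :
    Matrix.diagonal d * (V * Matrix.diagonal d * diagPseudoInv d)ᵀ = Matrix.diagonal d * Vᵀ := by
  ext i j
  simp only [diagPseudoInv, Matrix.diagonal_mul, Matrix.transpose_apply, Matrix.mul_diagonal]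
  rcases (hd i).lt_or_eq with h | h
  · rw [if_pos h]; field_simp
  · simp [← h]

/-- Hölder bound for the empirical process term (inequality (A.15)): under the three
dual-norm bounds on the noise, `⟨n⁻¹XᵀE, Ĉ − C*⟩ ≤ λ_a‖Â − A*‖₁ + λ_d‖D̂ − D*‖₁
+ λ_b‖B̂ − B*‖₁`. -/
theorem holder_bound_empirical_process {n p q : ℕ}
    (X : Matrix (Fin n) (Fin p) ℝ) (E : Matrix (Fin n) (Fin q) ℝ)
    (Uhat Ustar : Matrix (Fin p) (Fin q) ℝ)
    (Vhat Vstar : Matrix (Fin q) (Fin q) ℝ)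
    (dhat dstar : Fin q → ℝ) (hdhat : ∀ j, 0 ≤ dhat j) (hdstar : ∀ j, 0 ≤ dstar j)
    (lam_a lam_d lam_b : ℝ)
    (ha : supNorm ((n : ℝ)⁻¹ •
      (Xᵀ * E * (Vhat * Matrix.diagonal dhat) * diagPseudoInv dhat)) ≤ lam_a)
    (hd : supNorm ((n : ℝ)⁻¹ •
      (Ustarᵀ * Xᵀ * E * (Vhat * Matrix.diagonal dhat) * diagPseudoInv dhat)) ≤ lam_d)
    (hb : supNorm ((n : ℝ)⁻¹ • (Ustarᵀ * Xᵀ * E)) ≤ lam_b) :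
    mInner ((n : ℝ)⁻¹ • (Xᵀ * E))
        (Uhat * Matrix.diagonal dhat * Vhatᵀ - Ustar * Matrix.diagonal dstar * Vstarᵀ) ≤
      lam_a * l1Norm (Uhat * Matrix.diagonal dhat - Ustar * Matrix.diagonal dstar) +
        lam_d * l1Norm (Matrix.diagonal dhat - Matrix.diagonal dstar) +
        lam_b * l1Norm (Vhat * Matrix.diagonal dhat - Vstar * Matrix.diagonal dstar) := by
  set W := Vhat * Matrix.diagonal dhat * diagPseudoInv dhat with hW
  have hDW : Matrix.diagonal dhat * Wᵀ = Matrix.diagonal dhat * Vhatᵀ :=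
    diagonal_mul_W dhat hdhat Vhat
  have key : Uhat * Matrix.diagonal dhat * Vhatᵀ - Ustar * Matrix.diagonal dstar * Vstarᵀ =
      (Uhat * Matrix.diagonal dhat - Ustar * Matrix.diagonal dstar) * Wᵀ +
      Ustar * ((Matrix.diagonal dstar - Matrix.diagonal dhat) * Wᵀ) +
      Ustar * (Vhat * Matrix.diagonal dhat - Vstar * Matrix.diagonal dstar)ᵀ := by
    simp only [Matrix.transpose_sub, Matrix.transpose_mul, Matrix.diagonal_transpose,
      Matrix.sub_mul, Matrix.mul_sub, Matrix.mul_assoc, hDW]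
    abel
  rw [key, mInner_add, mInner_add, mInner_mul_transpose, mInner_mul_left, mInner_mul_transpose,
    mInner_mul_left, l1Norm_sub_comm (Matrix.diagonal dhat),
    ← l1Norm_transpose (Vhat * Matrix.diagonal dhat - Vstar * Matrix.diagonal dstar)]
  refine add_le_add (add_le_add ?_ ?_) ?_
  · apply mInner_le_of_supNorm_le
    simpa only [hW, Matrix.smul_mul, Matrix.mul_smul, Matrix.mul_assoc] using ha
  · apply mInner_le_of_supNorm_le
    simpa only [hW, Matrix.smul_mul, Matrix.mul_smul, Matrix.mul_assoc] using hd
  · apply mInner_le_of_supNorm_le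
    simpa only [Matrix.smul_mul, Matrix.mul_smul, Matrix.mul_assoc] using hb
end
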